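/- Let F_C ⊆ ℝ^d be an inhomogeneous self-similar set with the notation s, α, β, γ as given. Then the upper box dimension of F_C is at most max_{0≤x≤1} min{ xs+(1−x)β, xα+(1−x)d, α+(1−x)(β+d−1), α+xγ+(1−x)β }. -/

import Mathlib

open Filter

/-- The number of cubes from the `δ`-mesh on `ℝ^d` (products of half-open intervals
`[aδ, (a+1)δ)`, `a ∈ ℤ`) that intersect `E`. -/
noncomputable def meshCount (d : ℕ) (δ : ℝ) (E : Set (Fin d → ℝ)) : ℕ :=
  Set.ncard {a : Fin d → ℤ | ∃ x ∈ E, ∀ i, (a i : ℝ) * δ ≤ x i ∧ x i < ((a i : ℝ) + 1) * δ}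

/-- The upper box dimension of `E ⊆ ℝ^d`. -/
noncomputable def upperBoxDim (d : ℕ) (E : Set (Fin d → ℝ)) : ℝ :=
  Filter.limsup (fun δ : ℝ => Real.log (meshCount d δ E) / (-Real.log δ))
    (nhdsWithin 0 (Set.Ioi 0))

/-- The contraction ratio `c_I = c_{i₁} ⋯ c_{i_k}` of a finite word `I`. -/
def wordC {m : ℕ} (c : Fin m → ℝ) (I : List (Fin m)) : ℝ := (I.map c).prod

/-- The orthogonal part `M_{i₁} ⋯ M_{i_k}` of a finite word `I`. -/
def wordM {d m : ℕ} (M : Fin m → Matrix (Fin d) (Fin d) ℝ) (I : List (Fin m)) :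
    Matrix (Fin d) (Fin d) ℝ := (I.map M).prod

/-- The composition `S_I = S_{i₁} ∘ ⋯ ∘ S_{i_k}` along a finite word `I`. -/
def wordS {m : ℕ} {X : Type*} (S : Fin m → X → X) (I : List (Fin m)) : X → X :=
  I.foldr (fun i f => S i ∘ f) id

/-- `I_k`: the set of finite words `I` with `2^{-k-1} < c_I ≤ 2^{-k}`. -/
def wordIdx {m : ℕ} (c : Fin m → ℝ) (k : ℕ) : Set (List (Fin m)) :=
  {I | ((2 : ℝ) ^ (k + 1))⁻¹ < wordC c I ∧ wordC c I ≤ ((2 : ℝ) ^ k)⁻¹}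

/-- The set of maps `{T_I : I ∈ I_k}`, where `T_I(x) = c_I M_{i₁} ⋯ M_{i_k} x`. -/
def Tmaps (d m : ℕ) (c : Fin m → ℝ) (M : Fin m → Matrix (Fin d) (Fin d) ℝ) (k : ℕ) :
    Set ((Fin d → ℝ) → (Fin d → ℝ)) :=
  {f | ∃ I ∈ wordIdx c k, f = fun x => wordC c I • (wordM M I).mulVec x}

/-- `E` is covered by at most `N` closed balls of radius `r`. -/
def CoveredBy {d : ℕ} (E : Set (Fin d → ℝ)) (r N : ℝ) : Prop :=
  ∃ P : Finset (Fin d → ℝ), (P.card : ℝ) ≤ N ∧ ∀ x ∈ E, ∃ p ∈ P, dist x p ≤ r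

/-- The indices of the `δ`-mesh cubes that intersect `E`. -/
def meshSet {d : ℕ} (δ : ℝ) (E : Set (Fin d → ℝ)) : Set (Fin d → ℤ) :=
  {a | ∃ x ∈ E, ∀ i, (a i : ℝ) * δ ≤ x i ∧ x i < ((a i : ℝ) + 1) * δ}

namespace CoveredBy

variable {d : ℕ} {E A B : Set (Fin d → ℝ)} {r r' N N' : ℝ}

theorem mono (h : CoveredBy E r N) (hE : A ⊆ E) (hr : r ≤ r') (hN : N ≤ N') :
    CoveredBy A r' N' := by
  obtain ⟨P, hP, h⟩ := h
  refine ⟨P, hP.trans hN, fun x hx => ?_⟩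
  obtain ⟨p, hp, hxp⟩ := h x (hE hx)
  exact ⟨p, hp, hxp.trans hr⟩

theorem union (hA : CoveredBy A r N) (hB : CoveredBy B r N') : CoveredBy (A ∪ B) r (N + N') := by
  classical
  obtain ⟨P, hP, hA⟩ := hA
  obtain ⟨Q, hQ, hB⟩ := hB
  refine ⟨P ∪ Q, ?_, ?_⟩
  · have : ((P ∪ Q).card : ℝ) ≤ P.card + Q.card := mod_cast Finset.card_union_le P Q
    linarith
  · rintro x (hx | hx)
    · obtain ⟨p, hp, h⟩ := hA x hx
      exact ⟨p, Finset.mem_union_left _ hp, h⟩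
    · obtain ⟨p, hp, h⟩ := hB x hx
      exact ⟨p, Finset.mem_union_right _ hp, h⟩

theorem biUnion {ι : Type*} (T : Finset ι) (s : ι → Set (Fin d → ℝ))
    (h : ∀ i ∈ T, CoveredBy (s i) r N) : CoveredBy (⋃ i ∈ T, s i) r (T.card * N) := by
  classical
  induction T using Finset.induction_on with
  | empty => exact ⟨∅, by simp, by simp⟩
  | insert i T hi ih =>
    have h1 := (h i (Finset.mem_insert_self i T)).union
      (ih fun j hj => h j (Finset.mem_insert_of_mem hj))
    refine h1.mono ?_ le_rfl ?_
    · simp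
    · rw [Finset.card_insert_of_notMem hi]; push_cast; linarith

theorem add (hA : CoveredBy A r N) (hB : CoveredBy B r' N') :
    CoveredBy (Set.image2 (· + ·) A B) (r + r') (N * N') := by
  classical
  obtain ⟨P, hP, hA⟩ := hA
  obtain ⟨Q, hQ, hB⟩ := hB
  refine ⟨Finset.image₂ (· + ·) P Q, ?_, ?_⟩
  · have : ((Finset.image₂ (· + ·) P Q).card : ℝ) ≤ P.card * Q.card :=
      mod_cast Finset.card_image₂_le (· + ·) P Q
    exact this.trans (mul_le_mul hP hQ (by positivity) ((Nat.cast_nonneg _).trans hP))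
  · rintro _ ⟨x, hx, y, hy, rfl⟩
    obtain ⟨p, hp, h⟩ := hA x hx
    obtain ⟨q, hq, h'⟩ := hB y hy
    exact ⟨p + q, Finset.mem_image₂_of_mem hp hq, (dist_add_add_le _ _ _ _).trans (add_le_add h h')⟩

theorem image (h : CoveredBy E r N) {K : ℝ} (hK : 0 ≤ K) {f : (Fin d → ℝ) → (Fin d → ℝ)}
    (hf : ∀ x y, dist (f x) (f y) ≤ K * dist x y) : CoveredBy (f '' E) (K * r) N := by
  classical
  obtain ⟨P, hP, h⟩ := h
  refine ⟨P.image f, le_trans (mod_cast Finset.card_image_le) hP, ?_⟩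
  rintro _ ⟨x, hx, rfl⟩
  obtain ⟨p, hp, hxp⟩ := h x hx
  exact ⟨f p, Finset.mem_image_of_mem f hp, (hf x p).trans (by gcongr)⟩

theorem thicken (h : CoveredBy E r N) (hA : ∀ x ∈ A, ∃ y ∈ E, dist x y ≤ r') :
    CoveredBy A (r' + r) N := by
  obtain ⟨P, hP, h⟩ := h
  refine ⟨P, hP, fun x hx => ?_⟩
  obtain ⟨y, hy, hxy⟩ := hA x hx
  obtain ⟨p, hp, hyp⟩ := h y hy
  exact ⟨p, hp, (dist_triangle x y p).trans (add_le_add hxy hyp)⟩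

/-- If points with the same key are close, then the number of keys bounds a covering by balls
centred in the set. -/
theorem exists_centers_of_key {κ : Type*} (T : Finset κ) (f : (Fin d → ℝ) → κ)
    (hf : ∀ x ∈ E, f x ∈ T) (hr : ∀ x ∈ E, ∀ y ∈ E, f x = f y → dist x y ≤ r) :
    ∃ P : Finset (Fin d → ℝ), ↑P ⊆ E ∧ P.card ≤ T.card ∧ ∀ x ∈ E, ∃ p ∈ P, dist x p ≤ r := by
  classical
  choose! g hgE hg using fun (t : κ) (ht : ∃ x ∈ E, f x = t) => ht
  refine ⟨(T.filter fun t => ∃ x ∈ E, f x = t).image g, ?_,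
    Finset.card_image_le.trans (Finset.card_filter_le _ _), fun x hx => ?_⟩
  · intro y hy
    simp only [Finset.coe_image, Set.mem_image, Finset.coe_filter, Set.mem_ofPred_eq] at hy
    obtain ⟨t, ⟨-, ht⟩, rfl⟩ := hy
    exact hgE t ht
  · have hx' : ∃ y ∈ E, f y = f x := ⟨x, hx, rfl⟩
    refine ⟨g (f x), Finset.mem_image_of_mem g (by simpa using ⟨hf x hx, hx'⟩), ?_⟩
    exact hr x hx _ (hgE _ hx') (hg _ hx').symm

theorem of_key {κ : Type*} (T : Finset κ) (f : (Fin d → ℝ) → κ)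
    (hf : ∀ x ∈ E, f x ∈ T) (hr : ∀ x ∈ E, ∀ y ∈ E, f x = f y → dist x y ≤ r) :
    CoveredBy E r T.card := by
  obtain ⟨P, -, hP, h⟩ := exists_centers_of_key T f hf hr
  exact ⟨P, mod_cast hP, h⟩

theorem of_isBounded (hE : Bornology.IsBounded E) : ∃ R > 0, CoveredBy E R 1 := by
  obtain ⟨R, hR, h⟩ := hE.exists_pos_norm_le
  exact ⟨R, hR, {0}, by simp, fun x hx => ⟨0, by simp, by simpa using h x hx⟩⟩

theorem meshSet_le {δ Λ : ℝ} (hδ : 0 < δ) (hΛ : 0 ≤ Λ) (h : CoveredBy E (Λ * δ) N) :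
    (meshSet δ E).Finite ∧ (meshCount d δ E : ℝ) ≤ (2 * Λ + 2) ^ d * N := by
  classical
  obtain ⟨P, hP, h⟩ := h
  let box : (Fin d → ℝ) → Finset (Fin d → ℤ) := fun p =>
    Fintype.piFinset fun i => Finset.Icc ⌊p i / δ - Λ⌋ ⌊p i / δ + Λ⌋
  have hsub : meshSet δ E ⊆ ↑(P.biUnion box) := by
    rintro a ⟨x, hx, hax⟩
    obtain ⟨p, hp, hxp⟩ := h x hx
    simp only [Finset.coe_biUnion, Set.mem_iUnion]
    refine ⟨p, hp, ?_⟩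
    simp only [box, Finset.mem_coe, Fintype.mem_piFinset, Finset.mem_Icc]
    intro i
    have hd : |x i - p i| ≤ Λ * δ := by
      simpa [Real.dist_eq] using (dist_le_pi_dist x p i).trans hxp
    have ha : a i = ⌊x i / δ⌋ := by
      symm
      rw [Int.floor_eq_iff, le_div_iff₀ hδ, div_lt_iff₀ hδ]
      exact hax i
    rw [abs_le] at hd
    rw [ha]
    constructor <;> apply Int.floor_le_floor
    · rw [sub_le_iff_le_add, div_add' _ _ _ hδ.ne', div_le_div_iff_of_pos_right hδ]; linarith
    · rw [div_add' _ _ _ hδ.ne', div_le_div_iff_of_pos_right hδ]; linarith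
  refine ⟨(P.biUnion box).finite_toSet.subset hsub, ?_⟩
  have hbox : ∀ p ∈ P, ((box p).card : ℝ) ≤ (2 * Λ + 2) ^ d := by
    intro p _
    simp only [box, Fintype.card_piFinset, Int.card_Icc, Nat.cast_prod]
    calc _ ≤ ∏ _i : Fin d, (2 * Λ + 2) := by
          refine Finset.prod_le_prod (fun _ _ => Nat.cast_nonneg _) fun i _ => ?_
          have h1 := Int.floor_le (p i / δ + Λ)
          have h2 := Int.lt_floor_add_one (p i / δ - Λ)
          have h3 : (⌊p i / δ - Λ⌋ : ℤ) ≤ ⌊p i / δ + Λ⌋ := Int.floor_le_floor (by linarith)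
          have h4 : (((⌊p i / δ + Λ⌋ + 1 - ⌊p i / δ - Λ⌋).toNat : ℤ) : ℝ)
              = ⌊p i / δ + Λ⌋ + 1 - ⌊p i / δ - Λ⌋ := by
            rw [Int.toNat_of_nonneg (by linarith)]; push_cast; ring
          rw [Int.cast_natCast] at h4
          rw [h4]; linarith
      _ = _ := by simp
  have hcard : meshCount d δ E ≤ (P.biUnion box).card := by
    rw [← Set.ncard_coe_finset]
    exact Set.ncard_le_ncard hsub (Finset.finite_toSet _)
  calc (meshCount d δ E : ℝ) ≤ ((P.biUnion box).card : ℝ) := mod_cast hcard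
    _ ≤ ∑ p ∈ P, ((box p).card : ℝ) := mod_cast Finset.card_biUnion_le
    _ ≤ P.card * (2 * Λ + 2) ^ d := by
        simpa using Finset.sum_le_sum hbox
    _ ≤ _ := by rw [mul_comm]; gcongr

end CoveredBy

theorem exists_centers_of_meshSet_finite {d : ℕ} {E : Set (Fin d → ℝ)} {δ : ℝ} (hδ : 0 < δ)
    (hfin : (meshSet δ E).Finite) :
    ∃ P : Finset (Fin d → ℝ), ↑P ⊆ E ∧ P.card ≤ meshCount d δ E ∧
      ∀ x ∈ E, ∃ p ∈ P, dist x p ≤ δ := by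
  have key : ∀ (x : Fin d → ℝ) (i : Fin d), ((⌊x i / δ⌋ : ℤ) : ℝ) * δ ≤ x i ∧
      x i < ((⌊x i / δ⌋ : ℤ) + 1 : ℝ) * δ := by
    intro x i
    rw [← le_div_iff₀ hδ, ← div_lt_iff₀ hδ]
    exact ⟨Int.floor_le _, Int.lt_floor_add_one _⟩
  have hcard : hfin.toFinset.card = meshCount d δ E := (Set.ncard_eq_toFinset_card _ hfin).symm
  rw [← hcard]
  refine CoveredBy.exists_centers_of_key hfin.toFinset (fun x i => ⌊x i / δ⌋) ?_ ?_
  · intro x hx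
    rw [Set.Finite.mem_toFinset]
    exact ⟨x, hx, key x⟩
  · intro x _ y _ hxy
    rw [dist_pi_le_iff hδ.le]
    intro i
    have h1 := key x i
    have h2 := key y i
    rw [← congrFun hxy i] at h2
    rw [Real.dist_eq, abs_le]
    constructor <;> nlinarith

theorem CoveredBy.refine {d : ℕ} {E : Set (Fin d → ℝ)} {δ Λ N : ℝ} (hδ : 0 < δ) (hΛ : 0 ≤ Λ)
    (h : CoveredBy E (Λ * δ) N) : CoveredBy E δ ((2 * Λ + 2) ^ d * N) := by
  obtain ⟨hfin, hle⟩ := h.meshSet_le hδ hΛ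
  obtain ⟨P, -, hP, hcov⟩ := exists_centers_of_meshSet_finite hδ hfin
  exact ⟨P, le_trans (mod_cast hP) hle, hcov⟩

theorem upperBoxDim_le_of_coveredBy {d : ℕ} {E : Set (Fin d → ℝ)} {D : ℝ} (hD : 0 ≤ D)
    (h : ∀ ε > 0, ∃ Λ K : ℝ, ∀ u : ℝ, 0 ≤ u →
      CoveredBy E (Λ * 2 ^ (-u)) (K * 2 ^ (u * (D + ε)))) :
    upperBoxDim d E ≤ D := by
  refine le_of_forall_pos_le_add fun ε hε => ?_
  obtain ⟨Λ, K, h⟩ := h (ε / 2) (by positivity)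
  set Λ' := max Λ 0
  set K' := max ((2 * Λ' + 2) ^ d * K) 1
  have hK' : 0 < K' := lt_of_lt_of_le one_pos (le_max_right _ _)
  have hlog2 : 0 < Real.log 2 := Real.log_pos one_lt_two
  have hcount : ∀ u : ℝ, 0 ≤ u → (meshCount d (2 ^ (-u)) E : ℝ) ≤ K' * 2 ^ (u * (D + ε / 2)) := by
    intro u hu
    have hp : (0 : ℝ) < 2 ^ (-u) := by positivity
    have h1 : CoveredBy E (Λ' * 2 ^ (-u)) (K * 2 ^ (u * (D + ε / 2))) :=
      (h u hu).mono subset_rfl (by gcongr; exact le_max_left _ _) le_rfl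
    refine (h1.meshSet_le hp (le_max_right _ _)).2.trans ?_
    rw [← mul_assoc]
    gcongr
    exact le_max_left _ _
  have hev : ∀ᶠ δ : ℝ in nhdsWithin 0 (Set.Ioi 0), 1 + 2 * Real.log K' / ε ≤ -Real.log δ :=
    (tendsto_neg_atBot_atTop.comp Real.tendsto_log_nhdsGT_zero).eventually_ge_atTop _
  have hev' : ∀ᶠ δ : ℝ in nhdsWithin 0 (Set.Ioi 0), 0 < -Real.log δ :=
    (tendsto_neg_atBot_atTop.comp Real.tendsto_log_nhdsGT_zero).eventually_gt_atTop _
  refine limsup_le_of_le (isCoboundedUnder_le_of_eventually_le (x := 0) _ ?_) ?_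
  · filter_upwards [hev'] with δ hδ
    exact div_nonneg (Real.log_natCast_nonneg _) hδ.le
  · filter_upwards [hev, hev', self_mem_nhdsWithin] with δ h1 h2 hδ
    have hδ : 0 < δ := hδ
    rw [div_le_iff₀ h2]
    rcases Nat.eq_zero_or_pos (meshCount d δ E) with h0 | h0
    · rw [h0]; simp only [Nat.cast_zero, Real.log_zero]; positivity
    have hu : (2 : ℝ) ^ (-(-Real.log δ / Real.log 2)) = δ := by
      rw [Real.rpow_def_of_pos two_pos, ← neg_div, neg_neg, mul_div_cancel₀ _ hlog2.ne',
        Real.exp_log hδ]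
    have h3 := hcount (-Real.log δ / Real.log 2) (by positivity)
    rw [hu] at h3
    have h4 := Real.log_le_log (by exact_mod_cast h0) h3
    rw [Real.log_mul hK'.ne' (by positivity), Real.log_rpow two_pos] at h4
    have h5 : -Real.log δ / Real.log 2 * (D + ε / 2) * Real.log 2 = -Real.log δ * (D + ε / 2) := by
      field_simp
    have h6 : Real.log K' ≤ ε / 2 * -Real.log δ := by
      have : 2 * Real.log K' / ε ≤ -Real.log δ := by linarith
      rw [div_le_iff₀ hε] at this
      linarith
    linarith

theorem exists_centers_of_upperBoxDim {d : ℕ} {E : Set (Fin d → ℝ)}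
    (hE : Bornology.IsBounded E) {ε : ℝ} (hε : 0 < ε) :
    ∃ K > 0, ∀ u : ℝ, 0 ≤ u → ∃ P : Finset (Fin d → ℝ), ↑P ⊆ E ∧
      (P.card : ℝ) ≤ K * 2 ^ (u * (upperBoxDim d E + ε)) ∧
      ∀ x ∈ E, ∃ p ∈ P, dist x p ≤ 2 ^ (-u) := by
  obtain ⟨R, hR, hcov⟩ := CoveredBy.of_isBounded hE
  have hmesh : ∀ δ > 0, (meshSet δ E).Finite ∧ (meshCount d δ E : ℝ) ≤ (2 * (R / δ) + 2) ^ d := by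
    intro δ hδ
    have h1 : CoveredBy E (R / δ * δ) 1 := by rwa [div_mul_cancel₀ _ hδ.ne']
    simpa using h1.meshSet_le hδ (by positivity)
  have hlog2 : 0 < Real.log 2 := Real.log_pos one_lt_two
  have hpos : ∀ᶠ δ : ℝ in nhdsWithin 0 (Set.Ioi 0), 1 ≤ -Real.log δ :=
    (tendsto_neg_atBot_atTop.comp Real.tendsto_log_nhdsGT_zero).eventually_ge_atTop _
  have hbdd : IsBoundedUnder (· ≤ ·) (nhdsWithin 0 (Set.Ioi 0))
      (fun δ : ℝ => Real.log (meshCount d δ E) / (-Real.log δ)) := by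
    refine isBoundedUnder_of_eventually_le (a := d * (Real.log (2 * R + 2) + 1)) ?_
    filter_upwards [hpos, self_mem_nhdsWithin] with δ h1 hδ
    have hδ : 0 < δ := hδ
    have hδ1 : δ ≤ 1 := by
      by_contra! hlt
      have := Real.log_pos hlt
      linarith
    have hRlog : 0 ≤ Real.log (2 * R + 2) := Real.log_nonneg (by linarith)
    rw [div_le_iff₀ (by linarith)]
    rcases Nat.eq_zero_or_pos (meshCount d δ E) with h0 | h0
    · rw [h0]; simp only [Nat.cast_zero, Real.log_zero]
      have : 0 ≤ -Real.log δ := by linarith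
      positivity
    have h2 : (meshCount d δ E : ℝ) ≤ ((2 * R + 2) / δ) ^ d := by
      refine (hmesh δ hδ).2.trans ?_
      gcongr
      rw [add_div, mul_div_assoc]
      gcongr
      rw [le_div_iff₀ hδ]; linarith
    have h3 := Real.log_le_log (by exact_mod_cast h0) h2
    rw [Real.log_pow, Real.log_div (by positivity) hδ.ne'] at h3
    refine h3.trans ?_
    rw [mul_assoc]
    gcongr
    nlinarith
  have hev := eventually_lt_of_limsup_lt (b := upperBoxDim d E + ε)
    (lt_add_of_pos_right (upperBoxDim d E) hε) hbdd
  set β := upperBoxDim d E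
  have hev2 : ∀ᶠ δ : ℝ in nhdsWithin 0 (Set.Ioi 0),
      (meshCount d δ E : ℝ) ≤ δ ^ (-(β + ε)) := by
    filter_upwards [hev, hpos, self_mem_nhdsWithin] with δ h1 h2 hδ
    have hδ : 0 < δ := hδ
    rw [div_lt_iff₀ (by linarith)] at h1
    rcases Nat.eq_zero_or_pos (meshCount d δ E) with h0 | h0
    · rw [h0]; simp only [Nat.cast_zero]; positivity
    rw [← Real.log_le_log_iff (by exact_mod_cast h0) (by positivity), Real.log_rpow hδ]
    linarith
  obtain ⟨δ₀, hδ₀, hsmall⟩ := mem_nhdsGT_iff_exists_Ioo_subset.1 hev2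
  have hδ₀ : 0 < δ₀ := hδ₀
  set B := (2 * (R / δ₀) + 2) ^ d
  have hB : 0 < B := by positivity
  set w := |Real.logb 2 δ₀| * |β + ε|
  refine ⟨1 + B * 2 ^ w, by positivity, fun u hu => ?_⟩
  have hδ : (0 : ℝ) < 2 ^ (-u) := by positivity
  obtain ⟨P, hPE, hP, hcovP⟩ := exists_centers_of_meshSet_finite hδ (hmesh _ hδ).1
  refine ⟨P, hPE, le_trans (Nat.cast_le.2 hP) ?_, hcovP⟩
  have hp2 : (0 : ℝ) < 2 ^ (u * (β + ε)) := by positivity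
  have hpw : (0 : ℝ) < 2 ^ w := by positivity
  rcases lt_or_ge ((2 : ℝ) ^ (-u)) δ₀ with hlt | hge
  · have h1 : (meshCount d (2 ^ (-u)) E : ℝ) ≤ ((2 : ℝ) ^ (-u)) ^ (-(β + ε)) := hsmall ⟨hδ, hlt⟩
    rw [← Real.rpow_mul two_pos.le, neg_mul_neg] at h1
    nlinarith [mul_pos (mul_pos hB hpw) hp2]
  · have h1 : (meshCount d (2 ^ (-u)) E : ℝ) ≤ B := by
      refine (hmesh _ hδ).2.trans ?_
      simp only [B]; gcongr
    have h2 : u ≤ |Real.logb 2 δ₀| := by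
      have := (Real.logb_le_iff_le_rpow one_lt_two hδ₀).2 hge
      exact le_trans (by linarith) (neg_le_abs _)
    have h3 : 0 ≤ w + u * (β + ε) := by
      have h4 : u * |β + ε| ≤ w := by simp only [w]; gcongr
      have h5 : -(u * |β + ε|) ≤ u * (β + ε) := by
        rw [← mul_neg]; gcongr; exact neg_abs_le _
      linarith
    have h6 : (1 : ℝ) ≤ 2 ^ w * 2 ^ (u * (β + ε)) := by
      rw [← Real.rpow_add two_pos]; exact Real.one_le_rpow one_le_two h3
    nlinarith

section Words

variable {m : ℕ} {c : Fin m → ℝ}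

@[simp] theorem wordC_nil : wordC c [] = 1 := rfl

@[simp] theorem wordC_cons (i : Fin m) (I : List (Fin m)) :
    wordC c (i :: I) = c i * wordC c I := by simp [wordC]

theorem wordC_append (I J : List (Fin m)) : wordC c (I ++ J) = wordC c I * wordC c J := by
  simp [wordC]

theorem wordC_pos (hc : ∀ i, 0 < c i ∧ c i < 1) (I : List (Fin m)) : 0 < wordC c I := by
  induction I with
  | nil => simp
  | cons i I ih => rw [wordC_cons]; exact mul_pos (hc i).1 ih

theorem wordC_le_one (hc : ∀ i, 0 < c i ∧ c i < 1) (I : List (Fin m)) : wordC c I ≤ 1 := by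
  induction I with
  | nil => simp
  | cons i I ih => rw [wordC_cons]; exact mul_le_one₀ (hc i).2.le (wordC_pos hc I).le ih

/-- A power `a` such that every contraction ratio satisfies `c_i ^ a ≤ 1 / 2`. -/
theorem exists_pow_le_half (hc : ∀ i, 0 < c i ∧ c i < 1) :
    ∃ a : ℕ, 0 < a ∧ ∀ i, c i ^ a ≤ (2 : ℝ)⁻¹ := by
  choose n hn using fun i => exists_pow_lt_of_lt_one (by norm_num : (0 : ℝ) < 2⁻¹) (hc i).2
  refine ⟨1 + ∑ i, n i, by positivity, fun i => le_trans ?_ (hn i).le⟩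
  refine pow_le_pow_of_le_one (hc i).1.le (hc i).2.le ?_
  have := Finset.single_le_sum (f := n) (fun j _ => Nat.zero_le _) (Finset.mem_univ i)
  omega

theorem wordC_pow_le (hc : ∀ i, 0 < c i ∧ c i < 1) {a : ℕ} (ha : ∀ i, c i ^ a ≤ (2 : ℝ)⁻¹)
    (I : List (Fin m)) : wordC c I ^ a ≤ (2 : ℝ)⁻¹ ^ I.length := by
  induction I with
  | nil => simp
  | cons i I ih =>
    rw [wordC_cons, mul_pow, List.length_cons, pow_succ']
    exact mul_le_mul (ha i) ih (pow_nonneg (wordC_pos hc I).le _) (by norm_num)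

theorem length_lt_of_lt_wordC (hc : ∀ i, 0 < c i ∧ c i < 1) {a : ℕ} (ha0 : 0 < a)
    (ha : ∀ i, c i ^ a ≤ (2 : ℝ)⁻¹) {I : List (Fin m)} {j : ℕ}
    (h : ((2 : ℝ) ^ j)⁻¹ < wordC c I) : I.length < a * j := by
  by_contra! hle
  have h1 : (((2 : ℝ) ^ j)⁻¹) ^ a < wordC c I ^ a :=
    pow_lt_pow_left₀ h (by positivity) ha0.ne'
  have h2 : (2 : ℝ)⁻¹ ^ I.length ≤ (2 : ℝ)⁻¹ ^ (a * j) :=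
    pow_le_pow_of_le_one (by norm_num) (by norm_num) hle
  rw [← inv_pow, ← pow_mul, mul_comm j a] at h1
  exact absurd (h1.trans_le ((wordC_pow_le hc ha I).trans h2)) (lt_irrefl _)

theorem finite_lt_wordC (hc : ∀ i, 0 < c i ∧ c i < 1) (j : ℕ) :
    {I : List (Fin m) | ((2 : ℝ) ^ j)⁻¹ < wordC c I}.Finite := by
  obtain ⟨a, ha0, ha⟩ := exists_pow_le_half hc
  exact (List.finite_length_lt (Fin m) (a * j)).subset fun I hI =>
    length_lt_of_lt_wordC hc ha0 ha hI

theorem finite_wordIdx (hc : ∀ i, 0 < c i ∧ c i < 1) (k : ℕ) : (wordIdx c k).Finite :=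
  (finite_lt_wordC hc (k + 1)).subset fun _ hI => hI.1

theorem wordC_eq_prod_pow_count (I : List (Fin m)) : wordC c I = ∏ i, c i ^ I.count i := by
  induction I with
  | nil => simp
  | cons j I ih =>
    simp only [wordC_cons, ih, List.count_cons, pow_add, Finset.prod_mul_distrib]
    rw [mul_comm]
    congr 1
    simp [Finset.prod_ite_eq, pow_ite]

theorem sum_wordC_rpow_ofFn (hc : ∀ i, 0 < c i ∧ c i < 1) {s : ℝ} (hs : ∑ i, c i ^ s = 1) (n : ℕ) :
    ∑ f : Fin n → Fin m, wordC c (List.ofFn f) ^ s = 1 := by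
  have h := Fintype.sum_pow (fun i => c i ^ s) n
  rw [hs, one_pow] at h
  rw [h]
  refine Finset.sum_congr rfl fun f _ => ?_
  rw [Real.finsetProd_rpow _ _ fun i _ => (hc _).1.le, wordC, List.map_ofFn, List.prod_ofFn]
  rfl

theorem card_le_of_lt_wordC (hc : ∀ i, 0 < c i ∧ c i < 1) {s : ℝ} (hs0 : 0 ≤ s)
    (hs : ∑ i, c i ^ s = 1) {a : ℕ} (ha0 : 0 < a)
    (ha : ∀ i, c i ^ a ≤ (2 : ℝ)⁻¹) {j : ℕ} (T : Finset (List (Fin m)))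
    (hT : ∀ I ∈ T, ((2 : ℝ) ^ j)⁻¹ < wordC c I) :
    (T.card : ℝ) ≤ a * j * 2 ^ (j * s) := by
  classical
  have hfib : ∀ n ∈ Finset.range (a * j),
      ((T.filter fun I => I.length = n).card : ℝ) ≤ 2 ^ (j * s) := by
    intro n _
    set T' := T.filter fun I => I.length = n
    have hsub : T' ⊆ Finset.univ.image (List.ofFn : (Fin n → Fin m) → List (Fin m)) := by
      intro I hI
      obtain ⟨-, rfl⟩ := Finset.mem_filter.1 hI
      exact Finset.mem_image.2 ⟨I.get, Finset.mem_univ _, List.ofFn_get I⟩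
    have h1 : ∑ I ∈ T', wordC c I ^ s ≤ 1 := by
      refine (Finset.sum_le_sum_of_subset_of_nonneg hsub fun I _ _ =>
        Real.rpow_nonneg (wordC_pos hc I).le s).trans_eq ?_
      rw [Finset.sum_image fun f _ g _ h => List.ofFn_injective h, sum_wordC_rpow_ofFn hc hs]
    have h2 : T'.card • ((2 : ℝ) ^ (-(j * s))) ≤ ∑ I ∈ T', wordC c I ^ s := by
      refine Finset.card_nsmul_le_sum _ _ _ fun I hI => ?_
      have h3 := hT I (Finset.mem_filter.1 hI).1
      rw [← neg_mul, Real.rpow_mul two_pos.le, Real.rpow_neg two_pos.le, Real.rpow_natCast]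
      exact Real.rpow_le_rpow (by positivity) h3.le hs0
    rw [nsmul_eq_mul, Real.rpow_neg two_pos.le] at h2
    have h4 := h2.trans h1
    rwa [← div_eq_mul_inv, div_le_one (by positivity)] at h4
  have hmap : ∀ I ∈ T, I.length ∈ Finset.range (a * j) := fun I hI =>
    Finset.mem_range.2 (length_lt_of_lt_wordC hc ha0 ha (hT I hI))
  rw [Finset.card_eq_sum_card_fiberwise hmap]
  push_cast
  refine (Finset.sum_le_sum hfib).trans_eq ?_
  simp

/-- Polynomial factors are absorbed by exponential ones. -/
theorem exists_poly_le_rpow (p : ℕ) {ε : ℝ} (hε : 0 < ε) :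
    ∃ K > 0, ∀ u : ℝ, 0 ≤ u → (u + 1) ^ p ≤ K * (2 : ℝ) ^ (u * ε) := by
  have hq : 0 < ε * Real.log 2 / (p + 1) := by have := Real.log_pos one_lt_two; positivity
  set q := ε * Real.log 2 / (p + 1)
  refine ⟨(1 + q⁻¹) ^ p, by positivity, fun u hu => ?_⟩
  have h1 : u + 1 ≤ (1 + q⁻¹) * Real.exp (q * u) := by
    have h2 := Real.add_one_le_exp (q * u)
    have h3 : 1 ≤ Real.exp (q * u) := Real.one_le_exp (by positivity)
    have h4 : u = q⁻¹ * (q * u) := by field_simp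
    have h5 : q⁻¹ * (q * u) ≤ q⁻¹ * Real.exp (q * u) := by gcongr; linarith
    linarith
  refine (pow_le_pow_left₀ (by positivity) h1 p).trans ?_
  rw [mul_pow, ← Real.exp_nat_mul, Real.rpow_def_of_pos two_pos]
  have h6 : q * (p + 1) = ε * Real.log 2 := by simp only [q]; field_simp
  refine mul_le_mul_of_nonneg_left (Real.exp_le_exp.2 ?_) (by positivity)
  nlinarith [mul_nonneg hq.le hu]

theorem exists_card_le_of_lt_wordC (hc : ∀ i, 0 < c i ∧ c i < 1) {s : ℝ} (hs0 : 0 ≤ s)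
    (hs : ∑ i, c i ^ s = 1) {ε : ℝ} (hε : 0 < ε) :
    ∃ K > 0, ∀ (j : ℕ) (T : Finset (List (Fin m))),
      (∀ I ∈ T, ((2 : ℝ) ^ j)⁻¹ < wordC c I) → (T.card : ℝ) ≤ K * 2 ^ (j * (s + ε)) := by
  obtain ⟨a, ha0, ha⟩ := exists_pow_le_half hc
  obtain ⟨K, hK, hpoly⟩ := exists_poly_le_rpow 1 hε
  refine ⟨a * K, by positivity, fun j T hT => ?_⟩
  refine (card_le_of_lt_wordC hc hs0 hs ha0 ha T hT).trans ?_
  have h1 := hpoly j (Nat.cast_nonneg j)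
  rw [mul_add, add_comm, Real.rpow_add two_pos, mul_assoc, mul_assoc, ← mul_assoc K]
  gcongr
  linarith

theorem exists_card_values_le (hc : ∀ i, 0 < c i ∧ c i < 1) {ε : ℝ} (hε : 0 < ε) :
    ∃ K > 0, ∀ j : ℕ, ∃ V : Finset ℝ, (V.card : ℝ) ≤ K * 2 ^ (j * ε) ∧
      ∀ I : List (Fin m), ((2 : ℝ) ^ j)⁻¹ < wordC c I → wordC c I ∈ V := by
  classical
  obtain ⟨a, ha0, ha⟩ := exists_pow_le_half hc
  obtain ⟨K, hK, hpoly⟩ := exists_poly_le_rpow m hε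
  refine ⟨a ^ m * K, by positivity, fun j => ?_⟩
  refine ⟨(Fintype.piFinset fun _ : Fin m => Finset.range (a * j)).image
    fun e => ∏ i, c i ^ e i, ?_, fun I hI => ?_⟩
  · calc _ ≤ ((Fintype.piFinset fun _ : Fin m => Finset.range (a * j)).card : ℝ) :=
          mod_cast Finset.card_image_le
      _ = (a : ℝ) ^ m * (j : ℝ) ^ m := by simp [mul_pow]
      _ ≤ (a : ℝ) ^ m * (j + 1 : ℝ) ^ m := by gcongr; linarith
      _ ≤ _ := by
        rw [mul_assoc]
        exact mul_le_mul_of_nonneg_left (hpoly j (Nat.cast_nonneg j)) (by positivity)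
  · refine Finset.mem_image.2 ⟨fun i => I.count i, ?_, (wordC_eq_prod_pow_count I).symm⟩
    simp only [Fintype.mem_piFinset, Finset.mem_range]
    exact fun i => List.count_le_length.trans_lt (length_lt_of_lt_wordC hc ha0 ha hI)

end Words

section Similarities

variable {d m : ℕ} {c : Fin m → ℝ} {M : Fin m → Matrix (Fin d) (Fin d) ℝ}
  {b : Fin m → (Fin d → ℝ)} {S : Fin m → (Fin d → ℝ) → (Fin d → ℝ)}

theorem wordS_append {X : Type*} (S : Fin m → X → X) (I J : List (Fin m)) (x : X) :
    wordS S (I ++ J) x = wordS S I (wordS S J x) := by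
  induction I with
  | nil => rfl
  | cons i I ih => exact congrArg (S i) ih

theorem wordS_sub (hS : ∀ i x, S i x = c i • (M i).mulVec x + b i) (I : List (Fin m))
    (x y : Fin d → ℝ) :
    wordS S I x - wordS S I y = wordC c I • (wordM M I).mulVec (x - y) := by
  induction I with
  | nil => simp [wordS, wordM]
  | cons i I ih =>
    have h1 : wordS S (i :: I) x - wordS S (i :: I) y
        = c i • (M i).mulVec (wordS S I x - wordS S I y) := by
      change S i (wordS S I x) - S i (wordS S I y) = _
      rw [hS, hS, add_sub_add_right_eq_sub, ← smul_sub, Matrix.mulVec_sub]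
    have h2 : wordM M (i :: I) = M i * wordM M I := by simp [wordM]
    rw [h1, ih, wordC_cons, h2, Matrix.mulVec_smul, Matrix.mulVec_mulVec, smul_smul]

theorem wordM_mem (hM : ∀ i, M i ∈ Matrix.orthogonalGroup (Fin d) ℝ) (I : List (Fin m)) :
    wordM M I ∈ Matrix.orthogonalGroup (Fin d) ℝ := by
  refine list_prod_mem fun A hA => ?_
  obtain ⟨i, -, rfl⟩ := List.mem_map.1 hA
  exact hM i

theorem norm_mulVec_le_of_mem_orthogonalGroup {A : Matrix (Fin d) (Fin d) ℝ}
    (hA : A ∈ Matrix.orthogonalGroup (Fin d) ℝ) (x : Fin d → ℝ) : ‖A.mulVec x‖ ≤ d * ‖x‖ := by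
  rw [pi_norm_le_iff_of_nonneg (by positivity)]
  intro i
  calc ‖A.mulVec x i‖ ≤ ∑ j, ‖A i j * x j‖ := by
        rw [Matrix.mulVec, dotProduct]
        exact norm_sum_le _ _
    _ ≤ ∑ _j : Fin d, ‖x‖ := by
        refine Finset.sum_le_sum fun j _ => ?_
        rw [norm_mul]
        exact (mul_le_mul (entry_norm_bound_of_unitary hA i j) (norm_le_pi_norm x j)
          (norm_nonneg _) zero_le_one).trans_eq (one_mul _)
    _ = d * ‖x‖ := by simp

theorem sum_sq_mulVec_of_mem_orthogonalGroup {A : Matrix (Fin d) (Fin d) ℝ}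
    (hA : A ∈ Matrix.orthogonalGroup (Fin d) ℝ) (x : Fin d → ℝ) :
    ∑ i, A.mulVec x i ^ 2 = ∑ i, x i ^ 2 := by
  have h1 : A.mulVec x ⬝ᵥ A.mulVec x = x ⬝ᵥ x := by
    rw [Matrix.dotProduct_mulVec, ← Matrix.mulVec_transpose, Matrix.mulVec_mulVec]
    have h2 : A.transpose * A = 1 := by
      simpa [Matrix.star_eq_conjTranspose] using Unitary.star_mul_self_of_mem hA
    rw [h2, Matrix.one_mulVec]
  simpa [dotProduct, sq] using h1

theorem norm_smul_mulVec_le (hc : ∀ i, 0 < c i ∧ c i < 1)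
    (hM : ∀ i, M i ∈ Matrix.orthogonalGroup (Fin d) ℝ) (I : List (Fin m)) (x : Fin d → ℝ) :
    ‖wordC c I • (wordM M I).mulVec x‖ ≤ d * wordC c I * ‖x‖ := by
  rw [norm_smul, Real.norm_of_nonneg (wordC_pos hc I).le]
  nlinarith [mul_le_mul_of_nonneg_left (norm_mulVec_le_of_mem_orthogonalGroup (wordM_mem hM I) x)
    (wordC_pos hc I).le]

theorem dist_wordS_le (hc : ∀ i, 0 < c i ∧ c i < 1)
    (hM : ∀ i, M i ∈ Matrix.orthogonalGroup (Fin d) ℝ)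
    (hS : ∀ i x, S i x = c i • (M i).mulVec x + b i) (I : List (Fin m)) (x y : Fin d → ℝ) :
    dist (wordS S I x) (wordS S I y) ≤ d * wordC c I * dist x y := by
  rw [dist_eq_norm, dist_eq_norm, wordS_sub hS]
  exact norm_smul_mulVec_le hc hM I _

theorem wordS_mem {X : Type*} {S : Fin m → X → X} {F : Set X} (hF : ∀ i, S i '' F ⊆ F)
    (I : List (Fin m)) {x : X} (hx : x ∈ F) : wordS S I x ∈ F := by
  induction I with
  | nil => exact hx
  | cons i I ih => exact hF i ⟨_, ih, rfl⟩

/-- Follow the address of a point of an (inhomogeneous) invariant set until it either enters the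
condensation set or the cylinder has size about `t`. -/
theorem exists_word_of_mem {X : Type*} {S : Fin m → X → X} {F C : Set X}
    (hF : F ⊆ (⋃ i, S i '' F) ∪ C) (hc : ∀ i, 0 < c i ∧ c i < 1) {c₀ : ℝ} (hc₀ : ∀ i, c₀ ≤ c i)
    (hc₁ : c₀ < 1) {t : ℝ} (ht0 : 0 < t) (ht1 : t ≤ 1) {x : X} (hx : x ∈ F) :
    (∃ I, t < wordC c I ∧ x ∈ wordS S I '' C) ∨
      ∃ I, t * c₀ < wordC c I ∧ wordC c I ≤ t ∧ x ∈ wordS S I '' F := by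
  by_contra! hcon
  obtain ⟨hC, hF'⟩ := hcon
  have key : ∀ n : ℕ, ∃ I : List (Fin m), I.length = n ∧ t < wordC c I ∧ x ∈ wordS S I '' F := by
    intro n
    induction n with
    | zero =>
      have h0 : x ∈ wordS S [] '' F := ⟨x, hx, rfl⟩
      refine ⟨[], rfl, ?_, h0⟩
      by_contra! hle
      exact hF' [] (by simp; nlinarith) hle h0
    | succ n ih =>
      obtain ⟨I, hlen, ht, y, hy, rfl⟩ := ih
      rcases hF hy with h | h
      · obtain ⟨i, z, hz, rfl⟩ := Set.mem_iUnion.1 h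
        have hmem : wordS S I (S i z) ∈ wordS S (I ++ [i]) '' F :=
          ⟨z, hz, wordS_append S I [i] z⟩
        refine ⟨I ++ [i], by simp [hlen], ?_, hmem⟩
        by_contra! hle
        refine hF' _ ?_ hle hmem
        rw [wordC_append, wordC_cons, wordC_nil, mul_one]
        have := hc₀ i
        have := (hc i).1
        nlinarith
      · exact absurd ⟨y, h, rfl⟩ (hC I ht)
  obtain ⟨a, ha0, ha⟩ := exists_pow_le_half hc
  obtain ⟨j, hj⟩ := exists_pow_lt_of_lt_one ht0 (by norm_num : (2 : ℝ)⁻¹ < 1)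
  obtain ⟨I, hlen, ht, -⟩ := key (a * j)
  rw [inv_pow] at hj
  exact absurd (length_lt_of_lt_wordC hc ha0 ha (hj.trans ht)) (by omega)

end Similarities

theorem CoveredBy.sphere {d : ℕ} (hd : 0 < d) {R ρ : ℝ} (hR : 0 ≤ R) (hρ : 0 < ρ) :
    CoveredBy {x : Fin d → ℝ | ∑ i, x i ^ 2 = R ^ 2} (d ^ 2 * ρ)
      (2 * d * (2 * (R / ρ) + 2) ^ (d - 1)) := by
  classical
  have hRρ : 0 ≤ R / ρ := by positivity
  let σ : Bool → ℝ := fun t => if t then 1 else -1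
  let E : Fin d × Bool → Set (Fin d → ℝ) := fun q =>
    {x | ∑ i, x i ^ 2 = R ^ 2 ∧ (∀ j, x j ^ 2 ≤ x q.1 ^ 2) ∧ 0 ≤ σ q.2 * x q.1}
  have hE : ∀ q, CoveredBy (E q) (d ^ 2 * ρ) ((2 * (R / ρ) + 2) ^ (d - 1)) := by
    rintro ⟨i, t⟩
    let T : Finset (Fin d → ℤ) := Fintype.piFinset fun j =>
      if j = i then {0} else Finset.Icc ⌊-(R / ρ)⌋ ⌊R / ρ⌋
    have habs : ∀ x ∈ E (i, t), ∀ j, |x j| ≤ R := by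
      rintro x ⟨hx, -, -⟩ j
      refine abs_le_of_sq_le_sq ?_ hR
      rw [← hx]
      exact Finset.single_le_sum (f := fun i => x i ^ 2) (fun _ _ => sq_nonneg _)
        (Finset.mem_univ j)
    have hcard : (T.card : ℝ) ≤ (2 * (R / ρ) + 2) ^ (d - 1) := by
      have h1 : ((Finset.Icc ⌊-(R / ρ)⌋ ⌊R / ρ⌋).card : ℝ) ≤ 2 * (R / ρ) + 2 := by
        have h2 := Int.floor_le (R / ρ)
        have h3 := Int.lt_floor_add_one (-(R / ρ))
        have h4 : ⌊-(R / ρ)⌋ ≤ ⌊R / ρ⌋ := Int.floor_le_floor (by linarith)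
        have h5 : (((⌊R / ρ⌋ + 1 - ⌊-(R / ρ)⌋).toNat : ℤ) : ℝ) = ⌊R / ρ⌋ + 1 - ⌊-(R / ρ)⌋ := by
          rw [Int.toNat_of_nonneg (by linarith)]; push_cast; ring
        rw [Int.card_Icc, ← Int.cast_natCast, h5]
        linarith
      have h6 : T.card = (Finset.Icc ⌊-(R / ρ)⌋ ⌊R / ρ⌋).card ^ (d - 1) := by
        simp only [T, Fintype.card_piFinset]
        rw [← Finset.mul_prod_erase _ _ (Finset.mem_univ i), if_pos rfl, Finset.card_singleton,
          one_mul, Finset.prod_congr rfl fun j hj => by rw [if_neg (Finset.ne_of_mem_erase hj)],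
          Finset.prod_const, Finset.card_erase_of_mem (Finset.mem_univ i), Finset.card_fin]
      rw [h6]
      push_cast
      gcongr
    refine (CoveredBy.of_key (r := d ^ 2 * ρ) T
      (fun x j => if j = i then 0 else ⌊x j / ρ⌋) ?_ ?_).mono subset_rfl le_rfl hcard
    · intro x hx
      simp only [T, Fintype.mem_piFinset]
      intro j
      split_ifs with hj
      · simp
      · have h1 := abs_le.1 (habs x hx j)
        rw [Finset.mem_Icc]
        constructor <;> apply Int.floor_le_floor
        · rw [← neg_div, div_le_div_iff_of_pos_right hρ]; exact h1.1
        · rw [div_le_div_iff_of_pos_right hρ]; exact h1.2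
    · intro x hx y hy hxy
      have hd1 : (1 : ℝ) ≤ d := by exact_mod_cast i.pos
      have hclose : ∀ j, j ≠ i → |x j - y j| ≤ ρ := by
        intro j hj
        have h1 : ⌊x j / ρ⌋ = ⌊y j / ρ⌋ := by simpa [hj] using congrFun hxy j
        have h2 := Int.abs_sub_lt_one_of_floor_eq_floor h1
        rw [← sub_div, abs_div, abs_of_pos hρ, div_lt_one hρ] at h2
        exact h2.le
      have hlow : ∀ z ∈ E (i, t), R ≤ d * |z i| := by
        rintro z ⟨hz, hmax, -⟩
        refine abs_le_of_sq_le_sq' ?_ (by positivity) |>.2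
        have h1 : R ^ 2 ≤ d * z i ^ 2 := by
          rw [← hz]
          refine (Finset.sum_le_sum fun j _ => hmax j).trans_eq ?_
          simp
        rw [mul_pow, sq_abs]
        nlinarith [mul_nonneg (mul_nonneg (sub_nonneg.2 hd1) (by positivity : (0 : ℝ) ≤ d))
          (sq_nonneg (z i))]
      have hi : |x i - y i| ≤ d ^ 2 * ρ := by
        rcases hR.eq_or_lt with h0 | hRpos
        · have h1 := habs x hx i
          have h2 := habs y hy i
          rw [← h0] at h1 h2
          rw [abs_nonpos_iff.1 h1, abs_nonpos_iff.1 h2]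
          simp only [sub_self, abs_zero]
          positivity
        have hsign : |x i + y i| = |x i| + |y i| := by
          have h1 := hx.2.2
          have h2 := hy.2.2
          simp only [σ] at h1 h2
          cases t
          · simp only [Bool.false_eq_true, if_false] at h1 h2
            rw [abs_of_nonpos (by linarith : x i ≤ 0), abs_of_nonpos (by linarith : y i ≤ 0),
              abs_of_nonpos (by linarith)]
            ring
          · simp only [if_true] at h1 h2
            rw [abs_of_nonneg (by linarith : 0 ≤ x i), abs_of_nonneg (by linarith : 0 ≤ y i),
              abs_of_nonneg (by linarith)]
        have hsum : |x i ^ 2 - y i ^ 2| ≤ d * (2 * R * ρ) := by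
          have h1 := hx.1.trans hy.1.symm
          rw [← Finset.add_sum_erase _ _ (Finset.mem_univ i),
            ← Finset.add_sum_erase _ (fun j => y j ^ 2) (Finset.mem_univ i)] at h1
          have h2 : x i ^ 2 - y i ^ 2 = ∑ j ∈ Finset.univ.erase i, (y j ^ 2 - x j ^ 2) := by
            rw [Finset.sum_sub_distrib]; linarith
          rw [h2]
          calc _ ≤ ∑ j ∈ Finset.univ.erase i, |y j ^ 2 - x j ^ 2| := Finset.abs_sum_le_sum_abs _ _
            _ ≤ ∑ j ∈ Finset.univ.erase i, 2 * R * ρ := by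
                refine Finset.sum_le_sum fun j hj => ?_
                have h3 : y j ^ 2 - x j ^ 2 = (-(x j + y j)) * (x j - y j) := by ring
                rw [h3, abs_mul, abs_neg]
                refine mul_le_mul ?_ (hclose j (Finset.ne_of_mem_erase hj)) (abs_nonneg _)
                  (by positivity)
                have h4 := abs_add_le (x j) (y j)
                linarith [habs x hx j, habs y hy j]
            _ ≤ ∑ j : Fin d, 2 * R * ρ :=
                Finset.sum_le_sum_of_subset_of_nonneg (Finset.erase_subset _ _)
                  fun _ _ _ => by positivity
            _ = _ := by simp
        have h5 : x i ^ 2 - y i ^ 2 = (x i - y i) * (x i + y i) := by ring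
        rw [h5, abs_mul, hsign] at hsum
        have h6 := hlow x hx
        have h7 := hlow y hy
        have h8 : |x i - y i| * (2 * R) ≤ |x i - y i| * (d * (|x i| + |y i|)) :=
          mul_le_mul_of_nonneg_left (by linarith) (abs_nonneg _)
        have h9 : |x i - y i| * (2 * R) ≤ d ^ 2 * ρ * (2 * R) := by
          nlinarith [mul_le_mul_of_nonneg_left hsum (by positivity : (0 : ℝ) ≤ d)]
        exact le_of_mul_le_mul_right h9 (by positivity)
      rw [dist_pi_le_iff (by positivity)]
      intro j
      rw [Real.dist_eq]
      by_cases hj : j = i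
      · exact hj ▸ hi
      · exact (hclose j hj).trans (le_mul_of_one_le_left hρ.le (one_le_pow₀ hd1))
  refine (CoveredBy.biUnion Finset.univ E fun q _ => hE q).mono ?_ le_rfl ?_
  · intro x hx
    have : Nonempty (Fin d) := ⟨⟨0, hd⟩⟩
    obtain ⟨i, -, hi⟩ := Finset.exists_max_image Finset.univ (fun j => x j ^ 2)
      Finset.univ_nonempty
    simp only [Set.mem_iUnion, Finset.mem_univ, exists_true_left]
    rcases le_total 0 (x i) with h | h
    · exact ⟨(i, true), hx, fun j => hi j (Finset.mem_univ j), by simpa [σ] using h⟩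
    · exact ⟨(i, false), hx, fun j => hi j (Finset.mem_univ j), by simpa [σ] using h⟩
  · simp only [Finset.card_univ, Fintype.card_prod, Fintype.card_fin, Fintype.card_bool]
    push_cast
    linarith

theorem exists_ncard_Tmaps_le {d m : ℕ} {c : Fin m → ℝ} {M : Fin m → Matrix (Fin d) (Fin d) ℝ}
    (hc : ∀ i, 0 < c i ∧ c i < 1) {s γ ε : ℝ} (hs0 : 0 ≤ s) (hs : ∑ i, c i ^ s = 1)
    (hγ : limsup (fun k : ℕ => ((Tmaps d m c M k).ncard : ℝ) ^ (1 / (k : ℝ))) atTop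
      = (2 : ℝ) ^ γ) (hε : 0 < ε) :
    ∃ K > 0, ∀ k, (Tmaps d m c M k).Finite ∧
      ((Tmaps d m c M k).ncard : ℝ) ≤ K * 2 ^ (k * (γ + ε)) := by
  have hfinI := finite_wordIdx hc
  have himage : ∀ k, Tmaps d m c M k =
      (fun I => fun x => wordC c I • (wordM M I).mulVec x) '' wordIdx c k := by
    intro k
    ext f
    exact ⟨fun ⟨I, hI, hf⟩ => ⟨I, hI, hf.symm⟩, fun ⟨I, hI, hf⟩ => ⟨I, hI, hf.symm⟩⟩
  have hfin : ∀ k, (Tmaps d m c M k).Finite := fun k => himage k ▸ (hfinI k).image _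
  obtain ⟨K₁, hK₁, hcard⟩ := exists_card_le_of_lt_wordC hc hs0 hs one_pos
  have hcrude : ∀ k : ℕ, 1 ≤ k →
      ((Tmaps d m c M k).ncard : ℝ) ≤ (max K₁ 1 * 2 ^ (2 * (s + 1))) ^ k := by
    intro k hk
    have h1 : (Tmaps d m c M k).ncard ≤ (hfinI k).toFinset.card := by
      rw [himage, ← Set.ncard_eq_toFinset_card _ (hfinI k)]
      exact Set.ncard_image_le (hfinI k)
    have h2 := hcard (k + 1) (hfinI k).toFinset fun I hI => ((hfinI k).mem_toFinset.1 hI).1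
    calc ((Tmaps d m c M k).ncard : ℝ) ≤ ((hfinI k).toFinset.card : ℝ) := mod_cast h1
      _ ≤ K₁ * 2 ^ (((k + 1 : ℕ) : ℝ) * (s + 1)) := h2
      _ ≤ max K₁ 1 ^ k * 2 ^ (2 * (s + 1) * k) := by
          refine mul_le_mul ?_ (Real.rpow_le_rpow_of_exponent_le one_le_two ?_) (by positivity)
            (by positivity)
          · exact (le_max_left _ _).trans (le_self_pow₀ (le_max_right _ _) (by omega))
          · push_cast
            have : (1 : ℝ) ≤ k := by exact_mod_cast hk
            nlinarith
      _ = _ := by rw [mul_pow, Real.rpow_mul_natCast two_pos.le]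
  have hbdd : IsBoundedUnder (· ≤ ·) atTop
      (fun k : ℕ => ((Tmaps d m c M k).ncard : ℝ) ^ (1 / (k : ℝ))) := by
    refine isBoundedUnder_of_eventually_le (a := max K₁ 1 * 2 ^ (2 * (s + 1))) ?_
    filter_upwards [eventually_ge_atTop 1] with k hk
    rw [one_div]
    rw [Real.rpow_inv_le_iff_of_pos (by positivity) (by positivity) (by positivity),
      Real.rpow_natCast]
    exact hcrude k hk
  have hlt : limsup (fun k : ℕ => ((Tmaps d m c M k).ncard : ℝ) ^ (1 / (k : ℝ))) atTop
      < (2 : ℝ) ^ (γ + ε) := by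
    rw [hγ]; exact Real.rpow_lt_rpow_of_exponent_lt one_lt_two (by linarith)
  obtain ⟨k₀, hk₀⟩ := eventually_atTop.1
    ((eventually_lt_of_limsup_lt hlt hbdd).and (eventually_ge_atTop 1))
  have hp : ∀ k : ℕ, (0 : ℝ) < 2 ^ (k * (γ + ε)) := fun k => by positivity
  let w : ℕ → ℝ := fun k => ((Tmaps d m c M k).ncard : ℝ) / 2 ^ (k * (γ + ε))
  have hw : ∀ k, 0 ≤ w k := fun k => by positivity
  have hsum : 0 ≤ ∑ k ∈ Finset.range k₀, w k := Finset.sum_nonneg fun k _ => hw k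
  refine ⟨1 + ∑ k ∈ Finset.range k₀, w k, by linarith, fun k => ⟨hfin k, ?_⟩⟩
  rw [← div_le_iff₀ (hp k)]
  rcases lt_or_ge k k₀ with h | h
  · have := Finset.single_le_sum (fun j _ => hw j) (Finset.mem_range.2 h)
    exact this.trans (by linarith)
  · obtain ⟨h1, h2⟩ := hk₀ k h
    have h3 : ((Tmaps d m c M k).ncard : ℝ) ≤ 2 ^ (k * (γ + ε)) := by
      rw [one_div] at h1
      rw [mul_comm, Real.rpow_mul two_pos.le]
      exact (Real.rpow_inv_le_iff_of_pos (by positivity) (by positivity) (by positivity)).1 h1.le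
    have h4 := (div_le_one (hp k)).2 h3
    linarith

/-- The union of the level `k` copies `S_I(C)`, `I ∈ I_k`. -/
def cylinders {d m : ℕ} (S : Fin m → (Fin d → ℝ) → (Fin d → ℝ)) (c : Fin m → ℝ)
    (C : Set (Fin d → ℝ)) (k : ℕ) : Set (Fin d → ℝ) :=
  ⋃ I ∈ wordIdx c k, wordS S I '' C

/-- The vectors `T_I (x - p)` with `I ∈ I_k` and `x ∈ C`. -/
def displacements {d m : ℕ} (c : Fin m → ℝ) (M : Fin m → Matrix (Fin d) (Fin d) ℝ)
    (C : Set (Fin d → ℝ)) (p : Fin d → ℝ) (k : ℕ) : Set (Fin d → ℝ) :=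
  {v | ∃ I ∈ wordIdx c k, ∃ x ∈ C, v = wordC c I • (wordM M I).mulVec (x - p)}

theorem wordC_le_of_mem_wordIdx {m : ℕ} {c : Fin m → ℝ} {k : ℕ} {I : List (Fin m)}
    (hI : I ∈ wordIdx c k) : wordC c I ≤ (2 : ℝ) ^ (-(k : ℝ)) := by
  rw [Real.rpow_neg two_pos.le, Real.rpow_natCast]; exact hI.2

section Bounds

variable {d m : ℕ} {c : Fin m → ℝ} {M : Fin m → Matrix (Fin d) (Fin d) ℝ}
  {b : Fin m → (Fin d → ℝ)} {S : Fin m → (Fin d → ℝ) → (Fin d → ℝ)} {C F : Set (Fin d → ℝ)}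

theorem exists_coveredBy_cylinders_of_similarityDim (hc : ∀ i, 0 < c i ∧ c i < 1)
    (hM : ∀ i, M i ∈ Matrix.orthogonalGroup (Fin d) ℝ)
    (hS : ∀ i x, S i x = c i • (M i).mulVec x + b i) (hC : Bornology.IsBounded C)
    {s ε : ℝ} (hs0 : 0 ≤ s) (hs : ∑ i, c i ^ s = 1) (hε : 0 < ε) :
    ∃ K, ∀ (k : ℕ) (u : ℝ), k ≤ u → CoveredBy (cylinders S c C k) (2 ^ (-u))
      (K * 2 ^ (k * (s + ε) + (u - k) * (upperBoxDim d C + ε))) := by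
  obtain ⟨K₁, hK₁, hcard⟩ := exists_card_le_of_lt_wordC hc hs0 hs hε
  obtain ⟨K₂, hK₂, hcov⟩ := exists_centers_of_upperBoxDim hC hε
  refine ⟨(2 * d + 2) ^ d * (K₁ * 2 ^ (s + ε) * K₂), fun k u hku => ?_⟩
  obtain ⟨P, -, hP, hPcov⟩ := hcov (u - k) (sub_nonneg.2 hku)
  have hP' : CoveredBy C (2 ^ (-(u - k))) _ := ⟨P, hP, hPcov⟩
  have himage : ∀ I ∈ (finite_wordIdx hc k).toFinset, CoveredBy (wordS S I '' C) (d * 2 ^ (-u))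
      (K₂ * 2 ^ ((u - k) * (upperBoxDim d C + ε))) := by
    intro I hI
    have hI' := (finite_wordIdx hc k).mem_toFinset.1 hI
    have h1 := hP'.image (K := d * 2 ^ (-(k : ℝ))) (by positivity) (f := wordS S I)
      fun x y => (dist_wordS_le hc hM hS I x y).trans (by
        gcongr; exact wordC_le_of_mem_wordIdx hI')
    refine h1.mono subset_rfl (le_of_eq ?_) le_rfl
    rw [mul_assoc, ← Real.rpow_add two_pos]
    ring_nf
  have h2 := hcard (k + 1) (finite_wordIdx hc k).toFinset fun I hI =>
    ((finite_wordIdx hc k).mem_toFinset.1 hI).1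
  have h3 := (CoveredBy.biUnion _ _ himage).refine (by positivity) (Nat.cast_nonneg d)
  refine h3.mono ?_ le_rfl ?_
  · intro x hx
    simpa [cylinders] using hx
  · rw [mul_assoc]
    refine mul_le_mul_of_nonneg_left ?_ (by positivity)
    refine (mul_le_mul_of_nonneg_right h2 (by positivity)).trans_eq ?_
    push_cast
    rw [add_mul _ _ (s + ε), one_mul, Real.rpow_add two_pos _ (s + ε),
      Real.rpow_add two_pos (k * (s + ε))]
    ring

theorem exists_coveredBy_cylinders_of_ambient (hc : ∀ i, 0 < c i ∧ c i < 1)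
    (hM : ∀ i, M i ∈ Matrix.orthogonalGroup (Fin d) ℝ)
    (hS : ∀ i x, S i x = c i • (M i).mulVec x + b i) (hC : Bornology.IsBounded C)
    (hF : Bornology.IsBounded F) (hFne : F.Nonempty) (hFS : ∀ i, S i '' F ⊆ F)
    {ε : ℝ} (hε : 0 < ε) :
    ∃ K, ∀ (k : ℕ) (u : ℝ), k ≤ u → CoveredBy (cylinders S c C k) (2 ^ (-u))
      (K * 2 ^ (k * (upperBoxDim d F + ε) + (u - k) * d)) := by
  obtain ⟨p, hp⟩ := hFne
  obtain ⟨R, hR0, hR⟩ : ∃ R > 0, ∀ x ∈ C, dist x p ≤ R := by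
    obtain ⟨R, hR⟩ := hC.subset_closedBall p
    exact ⟨max R 1, by positivity, fun x hx => (hR hx).trans (le_max_left _ _)⟩
  obtain ⟨K, hK, hcov⟩ := exists_centers_of_upperBoxDim hF hε
  refine ⟨(2 * (d * R + 1) + 2) ^ d * K, fun k u hku => ?_⟩
  obtain ⟨P, -, hP, hPcov⟩ := hcov k (Nat.cast_nonneg k)
  have hP' : CoveredBy F (2 ^ (-(k : ℝ))) _ := ⟨P, hP, hPcov⟩
  have h1 := hP'.thicken (A := cylinders S c C k) (r' := d * 2 ^ (-(k : ℝ)) * R) (by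
    intro x hx
    simp only [cylinders, Set.mem_iUnion] at hx
    obtain ⟨I, hI, y, hy, rfl⟩ := hx
    refine ⟨wordS S I p, wordS_mem hFS I hp, (dist_wordS_le hc hM hS I y p).trans ?_⟩
    gcongr
    · exact wordC_le_of_mem_wordIdx hI
    · exact hR y hy)
  have hone : (1 : ℝ) ≤ 2 ^ (u - k) := Real.one_le_rpow one_le_two (sub_nonneg.2 hku)
  have hscale : d * (2 : ℝ) ^ (-(k : ℝ)) * R + 2 ^ (-(k : ℝ))
      = ((d * R + 1) * 2 ^ (u - k)) * 2 ^ (-u) := by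
    rw [mul_assoc _ ((2 : ℝ) ^ (u - k)), ← Real.rpow_add two_pos]
    ring_nf
  rw [hscale] at h1
  refine (h1.refine (by positivity) (by positivity)).mono subset_rfl le_rfl ?_
  have h2 : (2 * ((d * R + 1) * 2 ^ (u - k)) + 2) ^ d
      ≤ (2 * (d * R + 1) + 2) ^ d * 2 ^ ((u - k) * d) := by
    rw [Real.rpow_mul_natCast two_pos.le, ← mul_pow]
    gcongr
    nlinarith
  refine (mul_le_mul_of_nonneg_right h2 (by positivity)).trans_eq ?_
  rw [Real.rpow_add two_pos]
  ring

theorem exists_coveredBy_cylinders_of_displacements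
    (hS : ∀ i x, S i x = c i • (M i).mulVec x + b i) (hF : Bornology.IsBounded F)
    (hFS : ∀ i, S i '' F ⊆ F) {p : Fin d → ℝ} (hp : p ∈ F) {ε : ℝ} (hε : 0 < ε)
    {K : ℝ} {g : ℕ → ℝ → ℝ} (h : ∀ (k : ℕ) (u : ℝ), k ≤ u →
      CoveredBy (displacements c M C p k) (2 ^ (-u)) (K * 2 ^ g k u)) :
    ∃ K', ∀ (k : ℕ) (u : ℝ), k ≤ u → CoveredBy (cylinders S c C k) (2 ^ (-u))
      (K' * 2 ^ (u * (upperBoxDim d F + ε) + g k u)) := by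
  obtain ⟨K', hK', hcov⟩ := exists_centers_of_upperBoxDim hF hε
  refine ⟨6 ^ d * (K' * K), fun k u hku => ?_⟩
  obtain ⟨P, -, hP, hPcov⟩ := hcov u ((Nat.cast_nonneg k).trans hku)
  have hP' : CoveredBy F (2 ^ (-u)) _ := ⟨P, hP, hPcov⟩
  have h1 := hP'.add (h k u hku)
  rw [← two_mul] at h1
  refine (h1.refine (by positivity) (by norm_num)).mono ?_ le_rfl (le_of_eq ?_)
  · intro x hx
    simp only [cylinders, Set.mem_iUnion] at hx
    obtain ⟨I, hI, y, hy, rfl⟩ := hx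
    refine ⟨wordS S I p, wordS_mem hFS I hp, _, ⟨I, hI, y, hy, rfl⟩, ?_⟩
    change wordS S I p + _ = _
    rw [← wordS_sub hS, add_sub_cancel]
  · rw [Real.rpow_add two_pos]
    norm_num
    ring

theorem exists_coveredBy_displacements_of_Tmaps (hc : ∀ i, 0 < c i ∧ c i < 1)
    (hM : ∀ i, M i ∈ Matrix.orthogonalGroup (Fin d) ℝ) (hC : Bornology.IsBounded C)
    (p : Fin d → ℝ) {s γ ε : ℝ} (hs0 : 0 ≤ s) (hs : ∑ i, c i ^ s = 1)
    (hγ : limsup (fun k : ℕ => ((Tmaps d m c M k).ncard : ℝ) ^ (1 / (k : ℝ))) atTop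
      = (2 : ℝ) ^ γ) (hε : 0 < ε) :
    ∃ K, ∀ (k : ℕ) (u : ℝ), k ≤ u → CoveredBy (displacements c M C p k) (2 ^ (-u))
      (K * 2 ^ (k * (γ + ε) + (u - k) * (upperBoxDim d C + ε))) := by
  obtain ⟨K₁, hK₁, hcard⟩ := exists_ncard_Tmaps_le hc hs0 hs hγ hε
  obtain ⟨K₂, hK₂, hcov⟩ := exists_centers_of_upperBoxDim hC hε
  refine ⟨(2 * d + 2) ^ d * (K₁ * K₂), fun k u hku => ?_⟩
  obtain ⟨P, -, hP, hPcov⟩ := hcov (u - k) (sub_nonneg.2 hku)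
  have hP' : CoveredBy C (2 ^ (-(u - k))) _ := ⟨P, hP, hPcov⟩
  have himage : ∀ T ∈ (hcard k).1.toFinset, CoveredBy ((fun x => T (x - p)) '' C) (d * 2 ^ (-u))
      (K₂ * 2 ^ ((u - k) * (upperBoxDim d C + ε))) := by
    intro T hT
    obtain ⟨I, hI, rfl⟩ := (hcard k).1.mem_toFinset.1 hT
    have h1 := hP'.image (K := d * 2 ^ (-(k : ℝ))) (by positivity)
      (f := fun x => wordC c I • (wordM M I).mulVec (x - p)) fun x y => by
        rw [dist_eq_norm, dist_eq_norm, ← smul_sub, ← Matrix.mulVec_sub, sub_sub_sub_cancel_right]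
        refine (norm_smul_mulVec_le hc hM I _).trans ?_
        gcongr
        exact wordC_le_of_mem_wordIdx hI
    refine h1.mono subset_rfl (le_of_eq ?_) le_rfl
    rw [mul_assoc, ← Real.rpow_add two_pos]
    ring_nf
  have h3 := (CoveredBy.biUnion _ _ himage).refine (by positivity) (Nat.cast_nonneg d)
  refine h3.mono ?_ le_rfl ?_
  · rintro _ ⟨I, hI, x, hx, rfl⟩
    refine Set.mem_iUnion₂.2 ⟨_, (hcard k).1.mem_toFinset.2 ⟨I, hI, rfl⟩, x, hx, rfl⟩
  · rw [mul_assoc]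
    refine mul_le_mul_of_nonneg_left ?_ (by positivity)
    have h2 := (hcard k).2
    rw [Set.ncard_eq_toFinset_card _ (hcard k).1] at h2
    refine (mul_le_mul_of_nonneg_right h2 (by positivity)).trans_eq ?_
    rw [Real.rpow_add two_pos]
    ring

theorem exists_coveredBy_displacements_of_spheres (hd : 0 < d) (hc : ∀ i, 0 < c i ∧ c i < 1)
    (hM : ∀ i, M i ∈ Matrix.orthogonalGroup (Fin d) ℝ) (hC : Bornology.IsBounded C)
    (p : Fin d → ℝ) {ε : ℝ} (hε : 0 < ε) :
    ∃ K, ∀ (k : ℕ) (u : ℝ), k ≤ u → CoveredBy (displacements c M C p k) (2 ^ (-u))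
      (K * 2 ^ (k * ε + (u - k) * (upperBoxDim d C + ε) + (u - k) * (d - 1))) := by
  classical
  obtain ⟨K₁, hK₁, hval⟩ := exists_card_values_le hc hε
  obtain ⟨K₂, hK₂, hcov⟩ := exists_centers_of_upperBoxDim hC hε
  obtain ⟨R, hR0, hR⟩ : ∃ R > 0, ∀ x ∈ C, ‖x - p‖ ≤ R := by
    obtain ⟨R, hR⟩ := hC.subset_closedBall p
    refine ⟨max R 1, by positivity, fun x hx => ?_⟩
    rw [← dist_eq_norm]
    exact (hR hx).trans (le_max_left _ _)
  let L : ℝ := 2 * d * (2 * (d * R) + 2) ^ (d - 1)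
  refine ⟨(2 * (d + d ^ 2) + 2) ^ d * (K₁ * 2 ^ ε * K₂ * L), fun k u hku => ?_⟩
  obtain ⟨P, hPC, hP, hPcov⟩ := hcov (u - k) (sub_nonneg.2 hku)
  obtain ⟨V, hV, hVmem⟩ := hval (k + 1)
  have hone : (1 : ℝ) ≤ 2 ^ (u - k) := Real.one_le_rpow one_le_two (sub_nonneg.2 hku)
  let eucl : (Fin d → ℝ) → ℝ := fun x => Real.sqrt (∑ i, x i ^ 2)
  let Q : Finset (ℝ × (Fin d → ℝ)) := (V.filter fun v => 0 ≤ v ∧ v ≤ 2 ^ (-(k : ℝ))) ×ˢ P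
  have heucl : ∀ y ∈ P, eucl (y - p) ≤ d * R := by
    intro y hy
    refine Real.sqrt_le_iff.2 ⟨by positivity, ?_⟩
    calc ∑ i, (y - p) i ^ 2 ≤ ∑ _i : Fin d, R ^ 2 := by
          refine Finset.sum_le_sum fun i _ => sq_le_sq' ?_ ?_ <;>
          have h1 := abs_le.1 ((norm_le_pi_norm (y - p) i).trans (hR y (hPC hy)))
          exacts [h1.1, h1.2]
      _ = d * R ^ 2 := by simp
      _ ≤ d ^ 2 * R ^ 2 := by
          gcongr
          exact le_self_pow₀ (by exact_mod_cast hd) two_ne_zero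
      _ = _ := by ring
  have hsphere : ∀ q ∈ Q, CoveredBy {x : Fin d → ℝ | ∑ i, x i ^ 2 = (q.1 * eucl (q.2 - p)) ^ 2}
      (d ^ 2 * 2 ^ (-u)) (L * 2 ^ ((u - k) * (d - 1))) := by
    rintro ⟨v, y⟩ hq
    obtain ⟨hv, hy⟩ := Finset.mem_product.1 hq
    obtain ⟨-, hv0, hvk⟩ := Finset.mem_filter.1 hv
    have h0 : 0 ≤ v * eucl (y - p) := mul_nonneg hv0 (Real.sqrt_nonneg _)
    have hu : (0 : ℝ) < 2 ^ (-u) := by positivity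
    refine (CoveredBy.sphere hd h0 hu).mono subset_rfl le_rfl ?_
    have h1 : v * eucl (y - p) / 2 ^ (-u) ≤ d * R * 2 ^ (u - k) := by
      rw [div_le_iff₀ hu, mul_assoc, ← Real.rpow_add two_pos, mul_comm v]
      refine mul_le_mul (heucl y hy) (hvk.trans_eq ?_) hv0 (by positivity)
      ring_nf
    have h2 : (2 : ℝ) ^ ((u - k) * (d - 1)) = ((2 : ℝ) ^ (u - k)) ^ (d - 1) := by
      rw [← Real.rpow_mul_natCast two_pos.le, Nat.cast_sub hd, Nat.cast_one]
    rw [h2, mul_assoc (2 * (d : ℝ)), ← mul_pow]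
    gcongr
    nlinarith
  have hQ : (Q.card : ℝ) ≤
      K₁ * 2 ^ (((k + 1 : ℕ) : ℝ) * ε) * (K₂ * 2 ^ ((u - k) * (upperBoxDim d C + ε))) := by
    rw [Finset.card_product]
    push_cast
    refine mul_le_mul (le_trans (mod_cast Finset.card_filter_le _ _) (mod_cast hV)) hP
      (by positivity) (by positivity)
  have h3 := (CoveredBy.biUnion _ _ hsphere).thicken (A := displacements c M C p k)
    (r' := d * 2 ^ (-u)) (by
      rintro _ ⟨I, hI, x, hx, rfl⟩
      obtain ⟨y, hy, hxy⟩ := hPcov x hx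
      refine ⟨wordC c I • (wordM M I).mulVec (y - p), Set.mem_iUnion₂.2
        ⟨(wordC c I, y), Finset.mem_product.2 ⟨Finset.mem_filter.2 ⟨hVmem I hI.1,
          (wordC_pos hc I).le, wordC_le_of_mem_wordIdx hI⟩, hy⟩, ?_⟩, ?_⟩
      · change ∑ i, (wordC c I * (wordM M I).mulVec (y - p) i) ^ 2 = (wordC c I * eucl (y - p)) ^ 2
        simp only [mul_pow]
        rw [← Finset.mul_sum, sum_sq_mulVec_of_mem_orthogonalGroup (wordM_mem hM I),
          Real.sq_sqrt (Finset.sum_nonneg fun i _ => sq_nonneg _)]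
      · rw [dist_eq_norm, ← smul_sub, ← Matrix.mulVec_sub, sub_sub_sub_cancel_right]
        refine (norm_smul_mulVec_le hc hM I _).trans ?_
        rw [← dist_eq_norm]
        calc _ ≤ (d : ℝ) * 2 ^ (-(k : ℝ)) * 2 ^ (-(u - k)) := by
              gcongr
              exact wordC_le_of_mem_wordIdx hI
          _ = _ := by
              rw [mul_assoc, ← Real.rpow_add two_pos]
              ring_nf)
  rw [← add_mul] at h3
  refine (h3.refine (by positivity) (by positivity)).mono subset_rfl le_rfl ?_
  rw [mul_assoc ((2 * ((d : ℝ) + d ^ 2) + 2) ^ d)]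
  refine mul_le_mul_of_nonneg_left ?_ (by positivity)
  refine (mul_le_mul_of_nonneg_right hQ (by positivity)).trans_eq ?_
  push_cast
  rw [add_mul _ _ ε, one_mul, Real.rpow_add two_pos _ ε, Real.rpow_add two_pos _ ((u - k) * _),
    Real.rpow_add two_pos (k * ε)]
  ring

/-- The box dimension of a self-similar set is at most its similarity dimension. -/
theorem upperBoxDim_le_similarityDim (hc : ∀ i, 0 < c i ∧ c i < 1)
    (hM : ∀ i, M i ∈ Matrix.orthogonalGroup (Fin d) ℝ)
    (hS : ∀ i x, S i x = c i • (M i).mulVec x + b i) (hF : Bornology.IsBounded F)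
    (hFS : F ⊆ ⋃ i, S i '' F) {s : ℝ} (hs0 : 0 ≤ s) (hs : ∑ i, c i ^ s = 1) :
    upperBoxDim d F ≤ s := by
  classical
  refine upperBoxDim_le_of_coveredBy hs0 fun ε hε => ?_
  obtain ⟨K, hK, hcard⟩ := exists_card_le_of_lt_wordC hc hs0 hs hε
  obtain ⟨R, hR0, hR⟩ := CoveredBy.of_isBounded hF
  obtain ⟨c₀, hc₀0, hc₀1, hc₀⟩ : ∃ c₀ : ℝ, 0 < c₀ ∧ c₀ < 1 ∧ ∀ i, c₀ ≤ c i := by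
    have h0 : 0 < ∏ i, c i := Finset.prod_pos fun i _ => (hc i).1
    refine ⟨min (∏ i, c i) 2⁻¹, by positivity, (min_le_right _ _).trans_lt (by norm_num),
      fun i => (min_le_left _ _).trans ?_⟩
    rw [← Finset.mul_prod_erase _ _ (Finset.mem_univ i)]
    exact mul_le_of_le_one_right (hc i).1.le
      (Finset.prod_le_one (fun j _ => (hc j).1.le) fun j _ => (hc j).2.le)
  obtain ⟨n, hn⟩ := exists_pow_lt_of_lt_one hc₀0 (by norm_num : (2 : ℝ)⁻¹ < 1)
  refine ⟨d * R, K * 2 ^ ((n + 1) * (s + ε)), fun u hu => ?_⟩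
  set j : ℕ := ⌈u⌉₊ + n
  have hj : ((2 : ℝ) ^ j)⁻¹ ≤ 2 ^ (-u) * c₀ := by
    rw [pow_add, mul_inv]
    refine mul_le_mul ?_ (by rw [← inv_pow]; exact hn.le) (by positivity) (by positivity)
    rw [Real.rpow_neg two_pos.le, ← Real.rpow_natCast]
    gcongr
    · exact one_le_two
    · exact Nat.le_ceil u
  have hfin : {I : List (Fin m) | 2 ^ (-u) * c₀ < wordC c I ∧ wordC c I ≤ 2 ^ (-u)}.Finite :=
    (finite_lt_wordC hc j).subset fun I hI => hj.trans_lt hI.1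
  have himage : ∀ I ∈ hfin.toFinset, CoveredBy (wordS S I '' F) (d * R * 2 ^ (-u)) 1 := by
    intro I hI
    have hI' := (hfin.mem_toFinset.1 hI).2
    refine (hR.image (K := d * 2 ^ (-u)) (by positivity) (f := wordS S I)
      fun x y => (dist_wordS_le hc hM hS I x y).trans (by gcongr)).mono subset_rfl ?_ le_rfl
    exact le_of_eq (by ring)
  refine (CoveredBy.biUnion _ _ himage).mono ?_ le_rfl ?_
  · intro x hx
    have hFS' : F ⊆ (⋃ i, S i '' F) ∪ ∅ := by rwa [Set.union_empty]
    rcases exists_word_of_mem hFS' hc hc₀ hc₀1 (t := 2 ^ (-u)) (by positivity)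
      (Real.rpow_le_one_of_one_le_of_nonpos one_le_two (by linarith)) hx with
      ⟨I, -, hI⟩ | ⟨I, h1, h2, hI⟩
    · simp at hI
    · exact Set.mem_iUnion₂.2 ⟨I, hfin.mem_toFinset.2 ⟨h1, h2⟩, hI⟩
  · rw [mul_one]
    refine (hcard j _ fun I hI => hj.trans_lt (hfin.mem_toFinset.1 hI).1).trans ?_
    rw [mul_assoc, ← Real.rpow_add two_pos]
    gcongr
    · exact one_le_two
    · have h1 := (Nat.ceil_lt_add_one hu).le
      have h2 : (j : ℝ) = ⌈u⌉₊ + n := by simp [j]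
      rw [h2]
      nlinarith

end Bounds

/-- An upper bound for the box dimension of an inhomogeneous attractor from covers of the level `k`
copies of the condensation set. -/
theorem upperBoxDim_le_of_cylinders {d m : ℕ} {c : Fin m → ℝ}
    {M : Fin m → Matrix (Fin d) (Fin d) ℝ} {b : Fin m → (Fin d → ℝ)}
    {S : Fin m → (Fin d → ℝ) → (Fin d → ℝ)} {C F G : Set (Fin d → ℝ)}
    (hc : ∀ i, 0 < c i ∧ c i < 1) (hM : ∀ i, M i ∈ Matrix.orthogonalGroup (Fin d) ℝ)
    (hS : ∀ i x, S i x = c i • (M i).mulVec x + b i)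
    (hF : Bornology.IsBounded F) (hFne : F.Nonempty) (hFS : ∀ i, S i '' F ⊆ F)
    (hG : Bornology.IsBounded G) (hGS : G ⊆ (⋃ i, S i '' G) ∪ C)
    {D : ℝ} (hD : 0 ≤ D) (hFD : upperBoxDim d F ≤ D)
    (h : ∀ ε > 0, ∃ K, ∀ (k : ℕ) (u : ℝ), k ≤ u →
      CoveredBy (cylinders S c C k) (2 ^ (-u)) (K * 2 ^ (u * (D + ε)))) :
    upperBoxDim d G ≤ D := by
  obtain ⟨p, hp⟩ := hFne
  obtain ⟨R, hR0, hR⟩ : ∃ R > 0, ∀ x ∈ G, dist x p ≤ R := by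
    obtain ⟨R, hR⟩ := hG.subset_closedBall p
    exact ⟨max R 1, by positivity, fun x hx => (hR hx).trans (le_max_left _ _)⟩
  refine upperBoxDim_le_of_coveredBy hD fun ε hε => ?_
  obtain ⟨K₁, h1⟩ := h (ε / 2) (half_pos hε)
  obtain ⟨K₂, hK₂, h2⟩ := exists_centers_of_upperBoxDim hF hε
  obtain ⟨K₃, hK₃, h3⟩ := exists_poly_le_rpow 1 (half_pos hε)
  refine ⟨1 + d * R, K₃ * |K₁| + K₂, fun u hu => ?_⟩
  have hcyl : ∀ k ∈ Finset.range (⌊u⌋₊ + 1), CoveredBy (cylinders S c C k)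
      ((1 + d * R) * 2 ^ (-u)) (|K₁| * 2 ^ (u * (D + ε / 2))) := by
    intro k hk
    refine (h1 k u ((Nat.le_floor_iff hu).1 (Finset.mem_range_succ_iff.1 hk))).mono subset_rfl ?_ ?_
    · exact le_mul_of_one_le_left (by positivity) (le_add_of_nonneg_right (by positivity))
    · gcongr
      exact le_abs_self _
  obtain ⟨P, -, hP, hPcov⟩ := h2 u hu
  have hnear : CoveredBy {x | ∃ y ∈ F, dist x y ≤ d * R * 2 ^ (-u)} ((1 + d * R) * 2 ^ (-u))
      (K₂ * 2 ^ (u * (D + ε))) := by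
    have hPF : CoveredBy F (2 ^ (-u)) _ := ⟨P, hP, hPcov⟩
    refine (hPF.thicken fun x hx => hx).mono subset_rfl (le_of_eq (by ring)) ?_
    gcongr
    exact one_le_two
  refine ((CoveredBy.biUnion _ _ hcyl).union hnear).mono (fun x hx => ?_) le_rfl ?_
  · rcases exists_word_of_mem hGS hc (c₀ := 0) (fun i => (hc i).1.le) one_pos
      (t := 2 ^ (-u)) (by positivity)
      (Real.rpow_le_one_of_one_le_of_nonpos one_le_two (by linarith)) hx with
      ⟨I, hI, hxI⟩ | ⟨I, -, hI, y, hy, rfl⟩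
    · left
      obtain ⟨k, hk1, hk2⟩ := exists_nat_pow_near_of_lt_one (wordC_pos hc I) (wordC_le_one hc I)
        (by norm_num : (0 : ℝ) < 2⁻¹) (by norm_num)
      rw [inv_pow] at hk1 hk2
      have hku : (k : ℝ) < u := by
        have h4 := hI.trans_le hk2
        rw [← Real.rpow_natCast, ← Real.rpow_neg two_pos.le,
          Real.rpow_lt_rpow_left_iff one_lt_two] at h4
        linarith
      exact Set.mem_iUnion₂.2 ⟨k, Finset.mem_range_succ_iff.2 (Nat.le_floor hku.le),
        Set.mem_iUnion₂.2 ⟨I, ⟨hk1, hk2⟩, hxI⟩⟩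
    · right
      refine ⟨wordS S I p, wordS_mem hFS I hp, (dist_wordS_le hc hM hS I y p).trans ?_⟩
      calc _ ≤ d * 2 ^ (-u) * R := by
            gcongr
            exact hR y hy
        _ = _ := by ring
  · rw [Finset.card_range, add_mul]
    refine add_le_add ?_ le_rfl
    have h4 : ((⌊u⌋₊ + 1 : ℕ) : ℝ) ≤ K₃ * 2 ^ (u * (ε / 2)) := by
      refine le_trans ?_ (h3 u hu)
      push_cast
      rw [pow_one]
      gcongr
      exact Nat.floor_le hu
    refine (mul_le_mul_of_nonneg_right h4 (by positivity)).trans_eq ?_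
    rw [show u * (D + ε) = u * (ε / 2) + u * (D + ε / 2) by ring, Real.rpow_add two_pos]
    ring

/-- A bounded supremum over `[0, 1]` dominates every value and, since the empty suprema outside of
`[0, 1]` contribute `0`, it is nonnegative. -/
theorem iSup_Icc_nonneg_and_le {f : ℝ → ℝ} {B : ℝ} (hB : ∀ x ∈ Set.Icc (0 : ℝ) 1, |f x| ≤ B) :
    0 ≤ (⨆ x ∈ Set.Icc (0 : ℝ) 1, f x) ∧
      ∀ x ∈ Set.Icc (0 : ℝ) 1, f x ≤ ⨆ y ∈ Set.Icc (0 : ℝ) 1, f y := by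
  have hout : ∀ x ∉ Set.Icc (0 : ℝ) 1, (⨆ _ : x ∈ Set.Icc (0 : ℝ) 1, f x) = 0 := by
    intro x hx
    have : IsEmpty (x ∈ Set.Icc (0 : ℝ) 1) := ⟨hx⟩
    exact Real.iSup_of_isEmpty _
  have hbdd : BddAbove (Set.range fun x => ⨆ _ : x ∈ Set.Icc (0 : ℝ) 1, f x) := by
    refine ⟨max B 0, ?_⟩
    rintro _ ⟨x, rfl⟩
    by_cases hx : x ∈ Set.Icc (0 : ℝ) 1
    · exact (ciSup_pos hx).trans_le (((le_abs_self _).trans (hB x hx)).trans (le_max_left _ _))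
    · exact (hout x hx).trans_le (le_max_right _ _)
  refine ⟨?_, fun x hx => ?_⟩
  · refine le_trans (hout 2 ?_).ge (le_ciSup hbdd 2)
    norm_num
  · exact (ciSup_pos (f := fun _ : x ∈ Set.Icc (0 : ℝ) 1 => f x) hx).ge.trans (le_ciSup hbdd x)

/-- Theorem 5.8: the upper box dimension of an inhomogeneous self-similar set `F_C` is at
most `max_{0 ≤ x ≤ 1} min{xs+(1-x)β, xα+(1-x)d, α+(1-x)(β+d-1), α+xγ+(1-x)β}`. -/
theorem upper_bound_general (d m : ℕ) (hm : 0 < m) (c : Fin m → ℝ)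
    (M : Fin m → Matrix (Fin d) (Fin d) ℝ) (b : Fin m → (Fin d → ℝ))
    (hc : ∀ i, 0 < c i ∧ c i < 1)
    (hM : ∀ i, M i ∈ Matrix.orthogonalGroup (Fin d) ℝ)
    (S : Fin m → (Fin d → ℝ) → (Fin d → ℝ))
    (hS : ∀ i x, S i x = c i • (M i).mulVec x + b i)
    (C F₀ FC : Set (Fin d → ℝ)) (hCcpt : IsCompact C)
    (hF₀ne : F₀.Nonempty) (hF₀cpt : IsCompact F₀) (hF₀ : F₀ = ⋃ i, S i '' F₀)
    (hFCne : FC.Nonempty) (hFCcpt : IsCompact FC) (hFC : FC = (⋃ i, S i '' FC) ∪ C)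
    (s α β γ : ℝ)
    (hs0 : 0 ≤ s) (hs : ∑ i, c i ^ s = 1)
    (hα : α = upperBoxDim d F₀) (hβ : β = upperBoxDim d C)
    (hγ0 : 0 ≤ γ)
    (hγ : limsup (fun k : ℕ => ((Tmaps d m c M k).ncard : ℝ) ^ (1 / (k : ℝ))) atTop
      = (2 : ℝ) ^ γ) :
    upperBoxDim d FC ≤
      ⨆ x ∈ Set.Icc (0 : ℝ) 1,
        min (min (x * s + (1 - x) * β) (x * α + (1 - x) * d))
          (min (α + (1 - x) * (β + d - 1)) (α + x * γ + (1 - x) * β)) := by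
  have hFS : ∀ i, S i '' F₀ ⊆ F₀ := fun i =>
    (Set.subset_iUnion (fun i => S i '' F₀) i).trans hF₀.ge
  let f : ℝ → ℝ := fun x => min (min (x * s + (1 - x) * β) (x * α + (1 - x) * d))
    (min (α + (1 - x) * (β + d - 1)) (α + x * γ + (1 - x) * β))
  have hcont : Continuous f := by fun_prop
  obtain ⟨B, hB⟩ := isCompact_Icc.exists_bound_of_continuousOn
    (hcont.continuousOn (s := Set.Icc 0 1))
  obtain ⟨hD0, hD⟩ := iSup_Icc_nonneg_and_le hB
  change upperBoxDim d FC ≤ ⨆ x ∈ Set.Icc (0 : ℝ) 1, f x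
  set D := ⨆ x ∈ Set.Icc (0 : ℝ) 1, f x
  have hαs : α ≤ s := hα.trans_le
    (upperBoxDim_le_similarityDim hc hM hS hF₀cpt.isBounded hF₀.le hs0 hs)
  have hαD : α ≤ D := by
    refine le_trans (le_min (le_min ?_ ?_) (le_min ?_ ?_)) (hD 1 (by norm_num)) <;> linarith
  rcases Nat.eq_zero_or_pos d with rfl | hd
  · refine upperBoxDim_le_of_coveredBy hD0 fun ε hε => ⟨1, 1, fun u hu => ⟨{0}, ?_, fun x _ =>
      ⟨0, Finset.mem_singleton_self _, ?_⟩⟩⟩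
    · rw [Finset.card_singleton, one_mul, Nat.cast_one]
      exact Real.one_le_rpow one_le_two (by positivity)
    · rw [Subsingleton.elim x 0, dist_self]
      positivity
  refine upperBoxDim_le_of_cylinders hc hM hS hF₀cpt.isBounded hF₀ne hFS hFCcpt.isBounded hFC.le
    hD0 (hα ▸ hαD) fun ε hε => ?_
  have hC := hCcpt.isBounded
  have hF := hF₀cpt.isBounded
  obtain ⟨p, hp⟩ := hF₀ne
  have hε' := half_pos hε
  obtain ⟨K₁, h1⟩ := exists_coveredBy_cylinders_of_similarityDim hc hM hS hC hs0 hs hε'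
  obtain ⟨K₂, h2⟩ := exists_coveredBy_cylinders_of_ambient hc hM hS hC hF ⟨p, hp⟩ hFS hε'
  obtain ⟨K, hK⟩ := exists_coveredBy_displacements_of_spheres hd hc hM hC p hε'
  obtain ⟨K₃, h3⟩ := exists_coveredBy_cylinders_of_displacements hS hF hFS hp hε' hK
  obtain ⟨K', hK'⟩ := exists_coveredBy_displacements_of_Tmaps hc hM hC p hs0 hs hγ hε'
  obtain ⟨K₄, h4⟩ := exists_coveredBy_cylinders_of_displacements hS hF hFS hp hε' hK'
  rw [← hβ] at h1 h3 h4
  rw [← hα] at h2 h3 h4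
  refine ⟨|K₁| + |K₂| + |K₃| + |K₄|, fun k u hku => ?_⟩
  have hk0 : (0 : ℝ) ≤ k := Nat.cast_nonneg k
  have hu : 0 ≤ u := hk0.trans hku
  have hbound : ∀ {A e : ℝ}, A ≤ |K₁| + |K₂| + |K₃| + |K₄| → e ≤ u * (D + ε) →
      A * (2 : ℝ) ^ e ≤ (|K₁| + |K₂| + |K₃| + |K₄|) * 2 ^ (u * (D + ε)) := fun hA he =>
    mul_le_mul hA (Real.rpow_le_rpow_of_exponent_le one_le_two he) (by positivity) (by positivity)
  have hx : u * (k / u) = k := mul_div_cancel_of_imp' fun h0 => by linarith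
  have hmem : (k / u : ℝ) ∈ Set.Icc (0 : ℝ) 1 := ⟨by positivity, div_le_one_of_le₀ hku hu⟩
  have hkε := mul_le_mul_of_nonneg_right hku hε.le
  have hfx := hD _ hmem
  generalize (k / u : ℝ) = x at hx hfx
  have hscale : ∀ {v : ℝ}, v ≤ D → u * v ≤ u * D := fun hv => mul_le_mul_of_nonneg_left hv hu
  have a1 := abs_nonneg K₁
  have a2 := abs_nonneg K₂
  have a3 := abs_nonneg K₃
  have a4 := abs_nonneg K₄
  rw [← hx] at hkε
  have huε := mul_nonneg hu hε.le
  rcases min_le_iff.1 hfx with h | h <;> rcases min_le_iff.1 h with h | h <;> have h := hscale h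
  · refine (h1 k u hku).mono subset_rfl le_rfl (hbound (by linarith [le_abs_self K₁]) ?_)
    rw [← hx]
    linarith
  · refine (h2 k u hku).mono subset_rfl le_rfl (hbound (by linarith [le_abs_self K₂]) ?_)
    rw [← hx]
    linarith
  · refine (h3 k u hku).mono subset_rfl le_rfl (hbound (by linarith [le_abs_self K₃]) ?_)
    rw [← hx]
    linarith
  · refine (h4 k u hku).mono subset_rfl le_rfl (hbound (by linarith [le_abs_self K₄]) ?_)
    rw [← hx]
    linarith
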